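/- For every κ > 0 the one-sided derivatives m′₋(κ) := lim_{h↓0}(m(κ) − m(κ−h))/h and m′₊(κ) := lim_{h↓0}(m(κ+h) − m(κ))/h exist and satisfy the envelope identities m′₋(κ) = −(1/2)·inf_{ρ∈M(κ)} 𝓔(ρ,ρ) and m′₊(κ) = −(1/2)·sup_{ρ∈M(κ)} 𝓔(ρ,ρ). Moreover, the maps κ ↦ inf_{ρ∈M(κ)} 𝓔(ρ,ρ) and κ ↦ sup_{ρ∈M(κ)} 𝓔(ρ,ρ) are non-decreasing on (0,∞). -/

import Mathlib

open scoped BigOperators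
open Filter Topology Real MeasureTheory

noncomputable section

/-- The normalized Lebesgue measure `μ = (1/2π) dθ` on `[0, 2π)`. -/
def circleμ : Measure ℝ :=
  (ENNReal.ofReal (1 / (2 * π))) • (volume.restrict (Set.Ico (0:ℝ) (2 * π)))

/-- An admissible density: measurable, a.e. nonnegative, with total mass one and finite
entropy integral `∫ ρ |log ρ| dμ < ∞` (with the convention `0 · log 0 = 0`). -/
def IsAdmissible (ρ : ℝ → ℝ) : Prop :=
  Measurable ρ ∧ (∀ᵐ θ ∂circleμ, 0 ≤ ρ θ) ∧ (∫ θ, ρ θ ∂circleμ) = 1 ∧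
    Integrable (fun θ => ρ θ * |Real.log (ρ θ)|) circleμ

/-- The interaction energy `𝓔(ρ,ρ) = ∬ W(θ−φ) ρ(θ) ρ(φ) dμ(θ) dμ(φ)`. -/
def interactionE (W ρ : ℝ → ℝ) : ℝ :=
  ∫ θ, (∫ φ, W (θ - φ) * ρ θ * ρ φ ∂circleμ) ∂circleμ

/-- The free energy `𝓕(ρ,κ) = ∫ ρ log ρ dμ − (κ/2) 𝓔(ρ,ρ)`. -/
def freeEnergy (W : ℝ → ℝ) (ρ : ℝ → ℝ) (κ : ℝ) : ℝ :=
  (∫ θ, ρ θ * Real.log (ρ θ) ∂circleμ) - κ / 2 * interactionE W ρ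

/-- The minimum free energy `m(κ)`. -/
def minFreeEnergy (W : ℝ → ℝ) (κ : ℝ) : ℝ :=
  sInf {v : ℝ | ∃ ρ : ℝ → ℝ, IsAdmissible ρ ∧ v = freeEnergy W ρ κ}

/-- The set of global minimizers `M(κ)`. -/
def minimizers (W : ℝ → ℝ) (κ : ℝ) : Set (ℝ → ℝ) :=
  {ρ | IsAdmissible ρ ∧ freeEnergy W ρ κ = minFreeEnergy W κ}

/-- The set of values of the interaction energy over global minimizers at intensity `κ`. -/
def energySet (W : ℝ → ℝ) (κ : ℝ) : Set ℝ :=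
  {v : ℝ | ∃ ρ ∈ minimizers W κ, v = interactionE W ρ}

instance circleμ_prob : IsProbabilityMeasure circleμ := by
  constructor
  have hp : 0 < 2 * π := by positivity
  simp only [circleμ, Measure.smul_apply, MeasurableSet.univ, Measure.restrict_apply,
    Set.univ_inter, Real.volume_Ico, smul_eq_mul, sub_zero]
  rw [← ENNReal.ofReal_mul (by positivity)]
  rw [one_div, inv_mul_cancel₀ hp.ne', ENNReal.ofReal_one]

lemma circle_ae : ∀ᵐ θ ∂circleμ, θ ∈ Set.Icc (0:ℝ) (2 * π) := by
  unfold circleμ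
  apply Measure.ae_smul_measure
  filter_upwards [ae_restrict_mem measurableSet_Ico] with x hx
  exact ⟨hx.1, hx.2.le⟩

/-- potential -/
def pot (W g : ℝ → ℝ) (θ : ℝ) : ℝ := ∫ φ, W (θ - φ) * g φ ∂circleμ

/-- bilinear form -/
def bil (W f g : ℝ → ℝ) : ℝ := ∫ θ, pot W g θ * f θ ∂circleμ

lemma interactionE_eq (W ρ : ℝ → ℝ) : interactionE W ρ = bil W ρ ρ := by
  unfold interactionE bil pot
  congr 1; ext θ
  rw [← integral_mul_const]
  congr 1; ext φ; ring

lemma exists_bound (W : ℝ → ℝ) (hWc : Continuous W) (hWper : Function.Periodic W (2 * π)) :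
    ∃ C : ℝ, 0 ≤ C ∧ ∀ x, |W x| ≤ C := by
  obtain ⟨C, hC⟩ := (isCompact_Icc (a := (0:ℝ)) (b := 2 * π)).exists_bound_of_continuousOn
    hWc.continuousOn
  have h : ∀ x, |W x| ≤ C := by
    intro x
    obtain ⟨y, hy, hxy⟩ := hWper.exists_mem_Ico₀ (by positivity) x
    rw [hxy]
    exact hC y ⟨hy.1, hy.2.le⟩
  exact ⟨C, (abs_nonneg _).trans (h 0), h⟩

section
variable {W : ℝ → ℝ} {C : ℝ}

lemma integrable_ker (hWc : Continuous W) (hC : ∀ x, |W x| ≤ C) {g : ℝ → ℝ}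
    (hg : Integrable g circleμ) (θ : ℝ) : Integrable (fun φ => W (θ - φ) * g φ) circleμ :=
  hg.bdd_mul (c := C) (by fun_prop) (ae_of_all _ fun x => hC _)

lemma pot_bound (hWc : Continuous W) (hC : ∀ x, |W x| ≤ C) {g : ℝ → ℝ}
    (hg : Integrable g circleμ) (θ : ℝ) : |pot W g θ| ≤ C * ∫ φ, |g φ| ∂circleμ := by
  unfold pot
  rw [← integral_const_mul]
  refine (abs_integral_le_integral_abs).trans ?_
  refine integral_mono (integrable_ker hWc hC hg θ).abs (hg.abs.const_mul C) fun x => ?_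
  simp only [abs_mul]
  exact mul_le_mul_of_nonneg_right (hC _) (abs_nonneg _)

lemma pot_cont (hWc : Continuous W) (hC : ∀ x, |W x| ≤ C) {g : ℝ → ℝ}
    (hg : Integrable g circleμ) : Continuous (pot W g) := by
  unfold pot
  refine continuous_of_dominated (bound := fun φ => C * |g φ|) ?_ ?_ ?_ ?_
  · intro θ; exact (integrable_ker hWc hC hg θ).aestronglyMeasurable
  · intro θ
    refine ae_of_all _ fun x => ?_
    rw [Real.norm_eq_abs, abs_mul]
    exact mul_le_mul_of_nonneg_right (hC _) (abs_nonneg _)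
  · exact hg.abs.const_mul C
  · exact ae_of_all _ fun x => by fun_prop

lemma pot_sub (hWc : Continuous W) (hC : ∀ x, |W x| ≤ C) {f g : ℝ → ℝ}
    (hf : Integrable f circleμ) (hg : Integrable g circleμ) (θ : ℝ) :
    pot W (fun x => f x - g x) θ = pot W f θ - pot W g θ := by
  unfold pot
  rw [← integral_sub (integrable_ker hWc hC hf θ) (integrable_ker hWc hC hg θ)]
  congr 1; ext φ; ring

lemma pot_mid (hWc : Continuous W) (hC : ∀ x, |W x| ≤ C) {f g : ℝ → ℝ}
    (hf : Integrable f circleμ) (hg : Integrable g circleμ) (θ : ℝ) :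
    pot W (fun x => (f x + g x) / 2) θ = (pot W f θ + pot W g θ) / 2 := by
  unfold pot
  rw [← integral_add (integrable_ker hWc hC hf θ) (integrable_ker hWc hC hg θ), ← integral_div]
  congr 1; ext φ; ring

lemma integrable_pot (hWc : Continuous W) (hC : ∀ x, |W x| ≤ C) {f g : ℝ → ℝ}
    (hf : Integrable f circleμ) (hg : Integrable g circleμ) :
    Integrable (fun θ => pot W g θ * f θ) circleμ :=
  hf.bdd_mul (c := C * ∫ φ, |g φ| ∂circleμ) (pot_cont hWc hC hg).aestronglyMeasurable
    (ae_of_all _ fun x => pot_bound hWc hC hg x)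

lemma bil_le {f g : ℝ → ℝ} (hf : Integrable f circleμ) {K : ℝ}
    (hK : ∀ θ ∈ Set.Icc (0:ℝ) (2 * π), |pot W g θ| ≤ K) :
    |bil W f g| ≤ K * ∫ φ, |f φ| ∂circleμ := by
  unfold bil
  rw [← integral_const_mul]
  refine (abs_integral_le_integral_abs).trans ?_
  refine integral_mono_of_nonneg (ae_of_all _ fun x => abs_nonneg _) (hf.abs.const_mul K) ?_
  filter_upwards [circle_ae] with x hx
  simp only [abs_mul]
  exact mul_le_mul_of_nonneg_right (hK x hx) (abs_nonneg _)

lemma bil_mid (hWc : Continuous W) (hC : ∀ x, |W x| ≤ C) {f g : ℝ → ℝ}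
    (hf : Integrable f circleμ) (hg : Integrable g circleμ) :
    4 * bil W (fun x => (f x + g x) / 2) (fun x => (f x + g x) / 2)
      = 2 * bil W f f + 2 * bil W g g - bil W (fun x => f x - g x) (fun x => f x - g x) := by
  have h1 := integrable_pot hWc hC hf hf
  have h2 := integrable_pot hWc hC hg hg
  have h3 := integrable_pot hWc hC hf hg
  have h4 := integrable_pot hWc hC hg hf
  unfold bil
  simp only [pot_mid hWc hC hf hg, pot_sub hWc hC hf hg]
  have e1 : ∀ θ, (pot W f θ + pot W g θ) / 2 * ((f θ + g θ) / 2) = (1/4) * (((pot W f θ * f θ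
      + pot W g θ * g θ) + pot W g θ * f θ) + pot W f θ * g θ) := fun θ => by ring
  have e2 : ∀ θ, (pot W f θ - pot W g θ) * (f θ - g θ) = ((pot W f θ * f θ
      + pot W g θ * g θ) - pot W g θ * f θ) - pot W f θ * g θ := fun θ => by ring
  have h12 : Integrable (fun θ => pot W f θ * f θ + pot W g θ * g θ) circleμ := h1.add h2
  have h123 : Integrable (fun θ => pot W f θ * f θ + pot W g θ * g θ + pot W g θ * f θ) circleμ :=
    h12.add h3
  have h123' : Integrable (fun θ => pot W f θ * f θ + pot W g θ * g θ - pot W g θ * f θ) circleμ :=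
    h12.sub h3
  simp only [e1, e2]
  rw [integral_const_mul, integral_add h123 h4, integral_add h12 h3,
    integral_add h1 h2, integral_sub h123' h4, integral_sub h12 h3,
    integral_add h1 h2]
  ring

lemma bil_diff (hWc : Continuous W) (hC : ∀ x, |W x| ≤ C) {f g : ℝ → ℝ}
    (hf : Integrable f circleμ) (hg : Integrable g circleμ) :
    |bil W f f - bil W g g| ≤
      C * ((∫ φ, |f φ| ∂circleμ) + ∫ φ, |g φ| ∂circleμ) * ∫ φ, |f φ - g φ| ∂circleμ := by
  have h1 := integrable_pot hWc hC hf hf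
  have h2 := integrable_pot hWc hC hg hg
  have h3 := integrable_pot hWc hC hf hg
  have hd : Integrable (fun x => f x - g x) circleμ := hf.sub hg
  have e : bil W f f - bil W g g = bil W f (fun x => f x - g x) + bil W (fun x => f x - g x) g := by
    unfold bil
    simp only [pot_sub hWc hC hf hg, sub_mul, mul_sub]
    rw [integral_sub h1 h3, integral_sub h3 h2]; ring
  rw [e]
  refine (abs_add_le _ _).trans ?_
  have a := bil_le (W := W) hf (fun θ _ => pot_bound hWc hC hd θ)
  have b := bil_le (W := W) hd (fun θ _ => pot_bound hWc hC hg θ)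
  nlinarith
end

lemma mul_log_lb {x : ℝ} (hx : 0 ≤ x) : x - 1 ≤ x * Real.log x := by
  rcases hx.eq_or_lt with rfl | h
  · simp
  · have := Real.one_sub_inv_le_log_of_pos h
    calc x - 1 = x * (1 - x⁻¹) := by field_simp
      _ ≤ _ := mul_le_mul_of_nonneg_left this hx

lemma gap_aux {a m : ℝ} (ha : 0 ≤ a) (hm : a ≤ 2 * m) :
    2 * a - 2 * (√a * √m) ≤ a * Real.log a - a * Real.log m := by
  rcases ha.eq_or_lt with rfl | h
  · simp
  have hm' : 0 < m := by linarith
  have hsa := Real.sqrt_pos.2 h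
  have hsm := Real.sqrt_pos.2 hm'
  have h1 := Real.log_le_sub_one_of_pos (div_pos hsm hsa)
  rw [Real.log_div hsm.ne' hsa.ne', Real.log_sqrt ha, Real.log_sqrt hm'.le] at h1
  have h2 := mul_le_mul_of_nonneg_left h1 (mul_nonneg zero_le_two ha)
  have h3 : a * (√m / √a) = √a * √m := by
    rw [mul_div_assoc', div_eq_iff hsa.ne']
    nlinarith [Real.mul_self_sqrt ha]
  nlinarith

lemma gap_lb {a b : ℝ} (ha : 0 ≤ a) (hb : 0 ≤ b) :
    (√a - √b) ^ 2 / 2 ≤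
      a * Real.log a + b * Real.log b - 2 * ((a + b) / 2 * Real.log ((a + b) / 2)) := by
  have h1 := gap_aux (m := (a + b) / 2) ha (by linarith)
  have h2 := gap_aux (m := (a + b) / 2) hb (by linarith)
  have hm : 0 ≤ (a + b) / 2 := by linarith
  have s1 := Real.mul_self_sqrt ha
  have s2 := Real.mul_self_sqrt hb
  have s3 := Real.mul_self_sqrt hm
  have : (√a - √b) ^ 2 / 2 ≤ (2 * a - 2 * (√a * √((a + b) / 2)))
      + (2 * b - 2 * (√b * √((a + b) / 2))) := by
    nlinarith [sq_nonneg (√a + √b - 2 * √((a + b) / 2))]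
  linarith

lemma abs_sub_le_gap {a b t : ℝ} (ha : 0 ≤ a) (hb : 0 ≤ b) (ht : 0 < t) :
    |a - b| ≤ (a * Real.log a + b * Real.log b - 2 * ((a + b) / 2 * Real.log ((a + b) / 2))) / (2 * t)
      + 2 * t * (a + b) := by
  have h := gap_lb ha hb
  have s1 := Real.mul_self_sqrt ha
  have s2 := Real.mul_self_sqrt hb
  have h2 : |a - b| ≤ ((√a - √b) ^ 2 / 2) / (2 * t) + 2 * t * (a + b) := by
    have e : ((√a - √b) ^ 2 / 2) / (2 * t) + 2 * t * (a + b)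
       = ((√a - √b) ^ 2 + 8 * t ^ 2 * (a + b)) / (4 * t) := by field_simp; ring
    rw [e, le_div_iff₀ (by positivity)]
    have e2 : a - b = (√a - √b) * (√a + √b) := by nlinarith
    rw [e2, abs_mul, abs_of_nonneg (by positivity : 0 ≤ √a + √b)]
    nlinarith [sq_nonneg (|√a - √b| - 2 * t * (√a + √b)), sq_abs (√a - √b),
      mul_nonneg (sq_nonneg t) (sq_nonneg (√a - √b))]
  refine h2.trans ?_
  gcongr

lemma adm_integrable {ρ : ℝ → ℝ} (h : IsAdmissible ρ) : Integrable ρ circleμ := by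
  by_contra hn
  have := h.2.2.1
  rw [integral_undef hn] at this
  norm_num at this

lemma adm_ent {ρ : ℝ → ℝ} (h : IsAdmissible ρ) :
    Integrable (fun θ => ρ θ * Real.log (ρ θ)) circleμ := by
  have hm : Measurable (fun θ => ρ θ * Real.log (ρ θ)) := h.1.mul (Real.measurable_log.comp h.1)
  refine h.2.2.2.mono hm.aestronglyMeasurable (ae_of_all _ fun x => ?_)
  simp

lemma adm_of {ρ : ℝ → ℝ} (h1 : Measurable ρ) (h2 : ∀ᵐ θ ∂circleμ, 0 ≤ ρ θ)
    (h3 : (∫ θ, ρ θ ∂circleμ) = 1) (h4 : Integrable (fun θ => ρ θ * Real.log (ρ θ)) circleμ) :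
    IsAdmissible ρ := by
  refine ⟨h1, h2, h3, ?_⟩
  have hm : Measurable (fun θ => ρ θ * |Real.log (ρ θ)|) :=
    h1.mul (Real.measurable_log.comp h1).abs
  refine h4.mono hm.aestronglyMeasurable (ae_of_all _ fun x => ?_)
  simp

lemma adm_abs {ρ : ℝ → ℝ} (h : IsAdmissible ρ) : (∫ θ, |ρ θ| ∂circleμ) = 1 := by
  rw [← h.2.2.1]
  refine integral_congr_ae ?_
  filter_upwards [h.2.1] with x hx
  exact abs_of_nonneg hx

lemma adm_one : IsAdmissible (fun _ => (1:ℝ)) := by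
  refine adm_of measurable_const (ae_of_all _ fun _ => zero_le_one) (by simp) (by simp)

lemma adm_mid {a b : ℝ → ℝ} (ha : IsAdmissible a) (hb : IsAdmissible b) :
    IsAdmissible (fun x => (a x + b x) / 2) := by
  have hm : Measurable (fun x => (a x + b x) / 2) := (ha.1.add hb.1).div_const 2
  refine adm_of hm ?_ ?_ ?_
  · filter_upwards [ha.2.1, hb.2.1] with x hx hy
    positivity
  · rw [integral_div, integral_add (adm_integrable ha) (adm_integrable hb), ha.2.2.1, hb.2.2.1]
    norm_num
  · have hi : Integrable (fun x => (|a x * Real.log (a x)| + |b x * Real.log (b x)|) + 1) circleμ :=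
      ((adm_ent ha).abs.add (adm_ent hb).abs).add (integrable_const 1)
    have hm' : Measurable (fun x => (a x + b x) / 2 * Real.log ((a x + b x) / 2)) :=
      hm.mul (Real.measurable_log.comp hm)
    refine hi.mono' hm'.aestronglyMeasurable ?_
    filter_upwards [ha.2.1, hb.2.1] with x hx hy
    have g := gap_lb hx hy
    have l := mul_log_lb (x := (a x + b x) / 2) (by positivity)
    have q := sq_nonneg (√(a x) - √(b x))
    have p1 := le_abs_self (a x * Real.log (a x))
    have p2 := le_abs_self (b x * Real.log (b x))
    have p3 := abs_nonneg (a x * Real.log (a x))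
    have p4 := abs_nonneg (b x * Real.log (b x))
    rw [Real.norm_eq_abs, abs_le]
    constructor <;> linarith

lemma ent_nonneg {ρ : ℝ → ℝ} (h : IsAdmissible ρ) :
    0 ≤ ∫ θ, ρ θ * Real.log (ρ θ) ∂circleμ := by
  have : (∫ θ, (ρ θ - 1) ∂circleμ) = 0 := by
    rw [integral_sub (adm_integrable h) (integrable_const 1), h.2.2.1]; simp
  rw [← this]
  refine integral_mono_ae ((adm_integrable h).sub (integrable_const 1)) (adm_ent h) ?_
  filter_upwards [h.2.1] with x hx
  exact mul_log_lb hx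

section
variable {W : ℝ → ℝ} {C : ℝ}

lemma E_bound (hWc : Continuous W) (hC : ∀ x, |W x| ≤ C) {ρ : ℝ → ℝ} (h : IsAdmissible ρ) :
    |interactionE W ρ| ≤ C := by
  rw [interactionE_eq]
  have := bil_le (W := W) (adm_integrable h) (fun θ _ => pot_bound hWc hC (adm_integrable h) θ)
  simpa [adm_abs h] using this

lemma F_lb (hWc : Continuous W) (hC : ∀ x, |W x| ≤ C) {ρ : ℝ → ℝ} (h : IsAdmissible ρ) (κ : ℝ) :
    -(|κ / 2| * C) ≤ freeEnergy W ρ κ := by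
  unfold freeEnergy
  have h1 := ent_nonneg h
  have h2 : |κ / 2 * interactionE W ρ| ≤ |κ / 2| * C := by
    rw [abs_mul]; exact mul_le_mul_of_nonneg_left (E_bound hWc hC h) (abs_nonneg _)
  have := (abs_le.1 h2).2
  linarith

lemma m_le (hWc : Continuous W) (hC : ∀ x, |W x| ≤ C) {ρ : ℝ → ℝ} (h : IsAdmissible ρ) (κ : ℝ) :
    minFreeEnergy W κ ≤ freeEnergy W ρ κ := by
  refine csInf_le ⟨-(|κ / 2| * C), ?_⟩ ⟨ρ, h, rfl⟩
  rintro v ⟨r, hr, rfl⟩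
  exact F_lb hWc hC hr κ

lemma exists_near (W : ℝ → ℝ) (κ : ℝ) {ε : ℝ} (hε : 0 < ε) :
    ∃ ρ, IsAdmissible ρ ∧ freeEnergy W ρ κ < minFreeEnergy W κ + ε := by
  obtain ⟨v, ⟨ρ, h, rfl⟩, hv⟩ := Real.lt_sInf_add_pos
    (s := {v : ℝ | ∃ ρ : ℝ → ℝ, IsAdmissible ρ ∧ v = freeEnergy W ρ κ})
    ⟨_, _, adm_one, rfl⟩ hε
  exact ⟨ρ, h, hv⟩

lemma L1_est (hWc : Continuous W) (hC : ∀ x, |W x| ≤ C) {a b : ℝ → ℝ} (ha : IsAdmissible a)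
    (hb : IsAdmissible b) {κ K t : ℝ} (ht : 0 < t)
    (hK : ∀ θ ∈ Set.Icc (0:ℝ) (2 * π), |pot W a θ - pot W b θ| ≤ K) :
    (∫ θ, |a θ - b θ| ∂circleμ) ≤ ((freeEnergy W a κ - minFreeEnergy W κ)
      + (freeEnergy W b κ - minFreeEnergy W κ) + |κ| / 2 * K) / (2 * t) + 4 * t := by
  have ia := adm_integrable ha
  have ib := adm_integrable hb
  have hab := adm_mid ha hb
  have hd : Integrable (fun x => a x - b x) circleμ := ia.sub ib
  have hK0 : 0 ≤ K := (abs_nonneg _).trans (hK 0 ⟨le_rfl, by positivity⟩)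
  -- bilinear form of the difference
  have hB : |bil W (fun x => a x - b x) (fun x => a x - b x)| ≤ K * 2 := by
    have h1 := bil_le (W := W) (g := fun x => a x - b x) hd (K := K) (fun θ hθ => by
      rw [pot_sub hWc hC ia ib]; exact hK θ hθ)
    refine h1.trans (mul_le_mul_of_nonneg_left ?_ hK0)
    calc (∫ x, |a x - b x| ∂circleμ) ≤ ∫ x, (|a x| + |b x|) ∂circleμ :=
          integral_mono hd.abs (ia.abs.add ib.abs) (fun x => abs_sub _ _)
      _ = 2 := by rw [integral_add ia.abs ib.abs, adm_abs ha, adm_abs hb]; norm_num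
  have hm := m_le hWc hC hab κ
  have hmid := bil_mid hWc hC ia ib
  have hs : Integrable (fun θ => a θ * Real.log (a θ) + b θ * Real.log (b θ)) circleμ :=
    (adm_ent ha).add (adm_ent hb)
  have hg : Integrable (fun θ => a θ * Real.log (a θ) + b θ * Real.log (b θ)
      - 2 * ((a θ + b θ) / 2 * Real.log ((a θ + b θ) / 2))) circleμ :=
    hs.sub ((adm_ent hab).const_mul 2)
  have hsum : Integrable (fun θ => a θ + b θ) circleμ := ia.add ib
  have hG : (∫ θ, (a θ * Real.log (a θ) + b θ * Real.log (b θ)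
      - 2 * ((a θ + b θ) / 2 * Real.log ((a θ + b θ) / 2))) ∂circleμ) ≤
      (freeEnergy W a κ - minFreeEnergy W κ)
      + (freeEnergy W b κ - minFreeEnergy W κ) + |κ| / 2 * K := by
    rw [integral_sub hs ((adm_ent hab).const_mul 2), integral_add (adm_ent ha) (adm_ent hb),
      integral_const_mul]
    unfold freeEnergy at hm ⊢
    rw [interactionE_eq] at hm ⊢
    rw [interactionE_eq W b]
    have h3 : |κ * bil W (fun x => a x - b x) (fun x => a x - b x)| ≤ |κ| * (K * 2) := by
      rw [abs_mul]; exact mul_le_mul_of_nonneg_left hB (abs_nonneg _)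
    have h4 := (abs_le.1 h3).2
    have h5 : κ * (4 * bil W (fun x => (a x + b x) / 2) (fun x => (a x + b x) / 2)) =
      κ * (2 * bil W a a + 2 * bil W b b - bil W (fun x => a x - b x) (fun x => a x - b x)) := by
      rw [hmid]
    linarith
  calc (∫ θ, |a θ - b θ| ∂circleμ) ≤ ∫ θ, ((a θ * Real.log (a θ) + b θ * Real.log (b θ)
      - 2 * ((a θ + b θ) / 2 * Real.log ((a θ + b θ) / 2))) / (2 * t) + 2 * t * (a θ + b θ))
        ∂circleμ := by
        refine integral_mono_ae hd.abs ((hg.div_const _).add (hsum.const_mul _)) ?_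
        filter_upwards [ha.2.1, hb.2.1] with x hx hy
        exact abs_sub_le_gap hx hy ht
    _ = (∫ θ, (a θ * Real.log (a θ) + b θ * Real.log (b θ)
      - 2 * ((a θ + b θ) / 2 * Real.log ((a θ + b θ) / 2))) ∂circleμ) / (2 * t) + 4 * t := by
        rw [integral_add (hg.div_const _) (hsum.const_mul _), integral_div, integral_const_mul,
          integral_add ia ib, ha.2.2.1, hb.2.2.1]
        ring
    _ ≤ _ := by gcongr

lemma pot_equi (hWc : Continuous W) (hC : ∀ x, |W x| ≤ C) {ε : ℝ} (hε : 0 < ε) :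
    ∃ δ > 0, ∀ ρ, IsAdmissible ρ → ∀ x ∈ Set.Icc (0:ℝ) (2 * π), ∀ y ∈ Set.Icc (0:ℝ) (2 * π),
      |x - y| < δ → |pot W ρ x - pot W ρ y| ≤ ε := by
  have hu := (isCompact_Icc (a := -(2 * π)) (b := 2 * π)).uniformContinuousOn_of_continuous
    hWc.continuousOn
  obtain ⟨δ, hδ, H⟩ := Metric.uniformContinuousOn_iff.1 hu ε hε
  refine ⟨δ, hδ, fun ρ h x hx y hy hxy => ?_⟩
  have i := adm_integrable h
  unfold pot
  rw [← integral_sub (integrable_ker hWc hC i x) (integrable_ker hWc hC i y)]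
  refine (abs_integral_le_integral_abs).trans ?_
  calc _ ≤ ∫ φ, ε * |ρ φ| ∂circleμ := by
        refine integral_mono_of_nonneg (ae_of_all _ fun x => abs_nonneg _) (i.abs.const_mul ε) ?_
        filter_upwards [circle_ae] with φ hφ
        simp only [← sub_mul, abs_mul]
        refine mul_le_mul_of_nonneg_right ?_ (abs_nonneg _)
        have := H (x - φ) ⟨by linarith [hx.1, hφ.2], by linarith [hx.2, hφ.1]⟩ (y - φ)
          ⟨by linarith [hy.1, hφ.2], by linarith [hy.2, hφ.1]⟩ (by
            rw [Real.dist_eq]; simpa using hxy)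
        exact this.le
    _ = ε := by rw [integral_const_mul, adm_abs h, mul_one]

lemma pot_subseq (hWc : Continuous W) (hC : ∀ x, |W x| ≤ C) (ρ : ℕ → ℝ → ℝ)
    (hρ : ∀ n, IsAdmissible (ρ n)) :
    ∃ ns : ℕ → ℕ, StrictMono ns ∧ ∀ ε > 0, ∃ N, ∀ i ≥ N, ∀ j ≥ N,
      ∀ θ ∈ Set.Icc (0:ℝ) (2 * π), |pot W (ρ (ns i)) θ - pot W (ρ (ns j)) θ| ≤ ε := by
  let U : ℕ → BoundedContinuousFunction (Set.Icc (0:ℝ) (2 * π)) ℝ := fun n =>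
    BoundedContinuousFunction.mkOfCompact
      ⟨fun x => pot W (ρ n) x, (pot_cont hWc hC (adm_integrable (hρ n))).comp continuous_subtype_val⟩
  have hc : IsCompact (closure (Set.range U)) := by
    refine BoundedContinuousFunction.arzela_ascoli (Set.Icc (-C) C) isCompact_Icc _ ?_ ?_
    · rintro f x ⟨n, rfl⟩
      have := pot_bound hWc hC (adm_integrable (hρ n)) x
      rw [adm_abs (hρ n), mul_one] at this
      exact abs_le.1 this
    · intro x
      rw [Metric.equicontinuousAt_iff]
      intro ε hε
      obtain ⟨δ, hδ, H⟩ := pot_equi hWc hC (half_pos hε)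
      refine ⟨δ, hδ, fun y hy => ?_⟩
      rintro ⟨_, n, rfl⟩
      have := H (ρ n) (hρ n) x x.2 y y.2 (by
        rw [dist_comm] at hy; exact hy)
      exact lt_of_le_of_lt this (half_lt_self hε)
  obtain ⟨u, -, ns, hns, hlim⟩ := hc.tendsto_subseq (x := U)
    (fun n => subset_closure (Set.mem_range_self n))
  refine ⟨ns, hns, fun ε hε => ?_⟩
  obtain ⟨N, hN⟩ := Metric.cauchySeq_iff.1 hlim.cauchySeq ε hε
  refine ⟨N, fun i hi j hj θ hθ => ?_⟩
  have := BoundedContinuousFunction.dist_coe_le_dist (f := U (ns i)) (g := U (ns j)) ⟨θ, hθ⟩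
  exact this.trans (hN i hi j hj).le
end

lemma L1_complete (f : ℕ → ℝ → ℝ) (hf : ∀ n, Integrable (f n) circleμ)
    (hcau : ∀ ε > 0, ∃ N, ∀ i ≥ N, ∀ j ≥ N, (∫ θ, |f i θ - f j θ| ∂circleμ) < ε) :
    ∃ g : ℝ → ℝ, Measurable g ∧ Integrable g circleμ ∧
      Tendsto (fun n => ∫ θ, |f n θ - g θ| ∂circleμ) atTop (𝓝 0) := by
  have hd : ∀ i j, dist ((hf i).toL1 (f i)) ((hf j).toL1 (f j)) = ∫ θ, |f i θ - f j θ| ∂circleμ := by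
    intro i j
    rw [dist_eq_norm, ← Integrable.toL1_sub, L1.norm_of_fun_eq_integral_norm]
    rfl
  have hC : CauchySeq (fun n => (hf n).toL1 (f n)) := by
    rw [Metric.cauchySeq_iff]
    intro ε hε
    obtain ⟨N, hN⟩ := hcau ε hε
    exact ⟨N, fun i hi j hj => by rw [hd]; exact hN i hi j hj⟩
  obtain ⟨G, hG⟩ := cauchySeq_tendsto_of_complete hC
  refine ⟨G, (Lp.stronglyMeasurable G).measurable, L1.integrable_coeFn G, ?_⟩
  rw [tendsto_iff_dist_tendsto_zero] at hG
  refine hG.congr fun n => ?_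
  rw [dist_eq_norm, L1.norm_eq_integral_norm]
  refine integral_congr_ae ?_
  filter_upwards [Lp.coeFn_sub ((hf n).toL1 (f n)) G, (hf n).coeFn_toL1] with x h1 h2
  rw [h1, Pi.sub_apply, h2, Real.norm_eq_abs]

section
variable {W : ℝ → ℝ} {C : ℝ}

lemma compactness (hWc : Continuous W) (hC0 : 0 ≤ C) (hC : ∀ x, |W x| ≤ C) {κ : ℝ} (ρ : ℕ → ℝ → ℝ)
    (hρ : ∀ n, IsAdmissible (ρ n))
    (hF : Tendsto (fun n => freeEnergy W (ρ n) κ) atTop (𝓝 (minFreeEnergy W κ))) :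
    ∃ ns : ℕ → ℕ, StrictMono ns ∧ ∃ r ∈ minimizers W κ,
      Tendsto (fun n => interactionE W (ρ (ns n))) atTop (𝓝 (interactionE W r)) := by
  obtain ⟨ns, hns, hU⟩ := pot_subseq hWc hC ρ hρ
  have hF1 : Tendsto (fun n => freeEnergy W (ρ (ns n)) κ) atTop (𝓝 (minFreeEnergy W κ)) :=
    hF.comp hns.tendsto_atTop
  obtain ⟨g, gm, gi, hg⟩ := L1_complete (fun n => ρ (ns n)) (fun n => adm_integrable (hρ _)) (by
    intro ε hε
    have ht : 0 < ε / 8 := by positivity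
    set η := ε ^ 2 / 32 / (2 + |κ| / 2) with hη
    have hη0 : 0 < η := by positivity
    obtain ⟨N1, hN1⟩ := hU η hη0
    obtain ⟨N2, hN2⟩ := Metric.tendsto_atTop.1 hF1 η hη0
    refine ⟨max N1 N2, fun i hi j hj => ?_⟩
    have e := L1_est hWc hC (κ := κ) (hρ (ns i)) (hρ (ns j)) ht
      (hN1 i ((le_max_left _ _).trans hi) j ((le_max_left _ _).trans hj))
    have f1 := (abs_lt.1 (hN2 i ((le_max_right _ _).trans hi))).2
    have f2 := (abs_lt.1 (hN2 j ((le_max_right _ _).trans hj))).2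
    refine lt_of_le_of_lt e ?_
    have h3 : (freeEnergy W (ρ (ns i)) κ - minFreeEnergy W κ)
      + (freeEnergy W (ρ (ns j)) κ - minFreeEnergy W κ) + |κ| / 2 * η < ε ^ 2 / 16 := by
      have : η * (2 + |κ| / 2) = ε ^ 2 / 32 := by
        rw [hη]; field_simp
      nlinarith [sq_pos_of_pos hε]
    have h4 : ((freeEnergy W (ρ (ns i)) κ - minFreeEnergy W κ)
      + (freeEnergy W (ρ (ns j)) κ - minFreeEnergy W κ) + |κ| / 2 * η) / (2 * (ε / 8)) < ε / 4 := by
      rw [div_lt_iff₀ (by positivity)]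
      nlinarith
    linarith)
  -- a.e. subsequence
  have hm : TendstoInMeasure circleμ (fun n => ρ (ns n)) atTop g := by
    refine tendstoInMeasure_of_tendsto_eLpNorm one_ne_zero
      (fun n => (hρ _).1.aestronglyMeasurable) gm.aestronglyMeasurable ?_
    have : ∀ n, eLpNorm (ρ (ns n) - g) 1 circleμ
        = ENNReal.ofReal (∫ θ, |ρ (ns n) θ - g θ| ∂circleμ) := by
      intro n
      have hi : Integrable (fun θ => ρ (ns n) θ - g θ) circleμ := (adm_integrable (hρ _)).sub gi
      rw [eLpNorm_one_eq_lintegral_enorm, ← ofReal_integral_norm_eq_lintegral_enorm]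
      · rfl
      · exact hi
    simp only [this]
    simpa using ENNReal.tendsto_ofReal hg
  obtain ⟨ks, hks, hae⟩ := hm.exists_seq_tendsto_ae
  have hg2 := hg.comp hks.tendsto_atTop
  have hF2 := hF1.comp hks.tendsto_atTop
  have g0 : ∀ᵐ θ ∂circleμ, 0 ≤ g θ := by
    have : ∀ᵐ θ ∂circleμ, ∀ n, 0 ≤ ρ n θ := ae_all_iff.2 fun n => (hρ n).2.1
    filter_upwards [hae, this] with x h1 h2
    exact ge_of_tendsto' h1 fun n => h2 _
  have g1 : (∫ θ, g θ ∂circleμ) = 1 := by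
    have : ∀ n, |(∫ θ, g θ ∂circleμ) - 1| ≤ ∫ θ, |ρ (ns n) θ - g θ| ∂circleμ := by
      intro n
      rw [← (hρ (ns n)).2.2.1, abs_sub_comm, ← integral_sub (adm_integrable (hρ _)) gi]
      exact abs_integral_le_integral_abs
    have h0 : |(∫ θ, g θ ∂circleμ) - 1| ≤ 0 := ge_of_tendsto' hg this
    have := abs_nonpos_iff.1 h0
    linarith
  have gabs : (∫ θ, |g θ| ∂circleμ) = 1 := by
    rw [← g1]
    refine integral_congr_ae ?_
    filter_upwards [g0] with x hx
    exact abs_of_nonneg hx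
  have hE : Tendsto (fun n => interactionE W (ρ (ns n))) atTop (𝓝 (interactionE W g)) := by
    rw [tendsto_iff_dist_tendsto_zero]
    have hg' := hg.const_mul (C * (1 + 1))
    rw [mul_zero] at hg'
    refine squeeze_zero (fun n => dist_nonneg) (fun n => ?_) hg'
    rw [Real.dist_eq, interactionE_eq, interactionE_eq]
    have := bil_diff hWc hC (adm_integrable (hρ (ns n))) gi
    rwa [adm_abs (hρ _), gabs] at this
  have hE2 := hE.comp hks.tendsto_atTop
  have hS : Tendsto (fun n => (∫ θ, ρ (ns (ks n)) θ * Real.log (ρ (ns (ks n)) θ) ∂circleμ) + 1) atTop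
      (𝓝 (minFreeEnergy W κ + κ / 2 * interactionE W g + 1)) := by
    refine ((hF2.add (hE2.const_mul (κ / 2))).add_const 1).congr fun n => ?_
    simp [freeEnergy]
  set L := minFreeEnergy W κ + κ / 2 * interactionE W g + 1 with hL
  have hL0 : 0 ≤ L := ge_of_tendsto' hS fun n => by
    have := ent_nonneg (hρ (ns (ks n))); linarith
  have gme : Measurable (fun θ => g θ * Real.log (g θ) + 1) :=
    (gm.mul (Real.measurable_log.comp gm)).add_const 1
  have gnn : ∀ᵐ θ ∂circleμ, 0 ≤ g θ * Real.log (g θ) + 1 := by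
    filter_upwards [g0] with x hx
    have := mul_log_lb hx
    linarith
  have fatou : ∫⁻ θ, ENNReal.ofReal (g θ * Real.log (g θ) + 1) ∂circleμ ≤ ENNReal.ofReal L := by
    have hlim : Tendsto (fun n => ∫⁻ θ, ENNReal.ofReal
        (ρ (ns (ks n)) θ * Real.log (ρ (ns (ks n)) θ) + 1) ∂circleμ) atTop (𝓝 (ENNReal.ofReal L)) := by
      refine (ENNReal.tendsto_ofReal hS).congr fun n => ?_
      have ha := hρ (ns (ks n))
      have hi : Integrable (fun θ => ρ (ns (ks n)) θ * Real.log (ρ (ns (ks n)) θ) + 1) circleμ :=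
        (adm_ent ha).add (integrable_const 1)
      rw [← ofReal_integral_eq_lintegral_ofReal hi]
      · rw [integral_add (adm_ent ha) (integrable_const 1)]; simp
      · filter_upwards [ha.2.1] with x hx
        have := mul_log_lb hx
        simp only [Pi.zero_apply]
        linarith
    rw [← hlim.liminf_eq]
    refine le_trans (le_of_eq ?_) (lintegral_liminf_le fun n => ?_)
    · refine lintegral_congr_ae ?_
      filter_upwards [hae] with x hx
      have hc : Continuous (fun y : ℝ => ENNReal.ofReal (y * Real.log y + 1)) :=
        ENNReal.continuous_ofReal.comp (Real.continuous_mul_log.add continuous_const)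
      exact ((hc.tendsto (g x)).comp hx).liminf_eq.symm
    · have hm := (hρ (ns (ks n))).1
      exact ((hm.mul (Real.measurable_log.comp hm)).add_const 1).ennreal_ofReal
  have gint : Integrable (fun θ => g θ * Real.log (g θ) + 1) circleμ := by
    refine ⟨gme.aestronglyMeasurable, ?_⟩
    rw [hasFiniteIntegral_iff_ofReal gnn]
    exact lt_of_le_of_lt fatou ENNReal.ofReal_lt_top
  have gint' : Integrable (fun θ => g θ * Real.log (g θ)) circleμ := by
    have := gint.sub (integrable_const 1)
    refine this.congr (ae_of_all _ fun x => ?_)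
    simp
  have gadm := adm_of gm g0 g1 gint'
  refine ⟨ns, hns, g, ⟨gadm, le_antisymm ?_ (m_le hWc hC gadm κ)⟩, hE⟩
  rw [← ofReal_integral_eq_lintegral_ofReal gint gnn, ENNReal.ofReal_le_ofReal_iff hL0,
    integral_add gint' (integrable_const 1)] at fatou
  unfold freeEnergy
  simp at fatou
  linarith

lemma min_nonempty (hWc : Continuous W) (hC0 : 0 ≤ C) (hC : ∀ x, |W x| ≤ C) (κ : ℝ) :
    (minimizers W κ).Nonempty := by
  have h : ∀ n : ℕ, ∃ ρ, IsAdmissible ρ ∧ freeEnergy W ρ κ < minFreeEnergy W κ + 1 / ((n:ℝ) + 1) :=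
    fun n => exists_near W κ (by positivity)
  choose ρ h1 h2 using h
  obtain ⟨_, _, r, hr, _⟩ := compactness hWc hC0 hC (κ := κ) ρ h1 (by
    refine tendsto_of_tendsto_of_tendsto_of_le_of_le tendsto_const_nhds ?_
      (fun n => m_le hWc hC (h1 n) κ) (fun n => (h2 n).le)
    simpa using (tendsto_const_nhds (x := minFreeEnergy W κ)).add
      (tendsto_one_div_add_atTop_nhds_zero_nat (𝕜 := ℝ)))
  exact ⟨r, hr⟩

lemma F_shift (ρ : ℝ → ℝ) (κ κ' : ℝ) :
    freeEnergy W ρ κ' = freeEnergy W ρ κ - (κ' - κ) / 2 * interactionE W ρ := by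
  unfold freeEnergy; ring

/-- basic inequality -/
lemma m_shift (hWc : Continuous W) (hC : ∀ x, |W x| ≤ C) {ρ : ℝ → ℝ} {κ : ℝ}
    (h : ρ ∈ minimizers W κ) (κ' : ℝ) :
    minFreeEnergy W κ' ≤ minFreeEnergy W κ - (κ' - κ) / 2 * interactionE W ρ := by
  rw [← h.2, ← F_shift]
  exact m_le hWc hC h.1 κ'

lemma es_bound (hWc : Continuous W) (hC : ∀ x, |W x| ≤ C) (κ : ℝ) :
    BddAbove (energySet W κ) ∧ BddBelow (energySet W κ) := by
  constructor
  · refine ⟨C, ?_⟩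
    rintro v ⟨ρ, h, rfl⟩
    exact (abs_le.1 (E_bound hWc hC h.1)).2
  · refine ⟨-C, ?_⟩
    rintro v ⟨ρ, h, rfl⟩
    exact (abs_le.1 (E_bound hWc hC h.1)).1

lemma es_nonempty (hWc : Continuous W) (hC0 : 0 ≤ C) (hC : ∀ x, |W x| ≤ C) (κ : ℝ) :
    (energySet W κ).Nonempty := by
  obtain ⟨r, hr⟩ := min_nonempty hWc hC0 hC κ
  exact ⟨_, r, hr, rfl⟩

lemma usc (hWc : Continuous W) (hC0 : 0 ≤ C) (hC : ∀ x, |W x| ≤ C) (κ : ℝ) {ε : ℝ} (hε : 0 < ε) :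
    ∃ δ > 0, ∀ κ', |κ' - κ| < δ → ∀ ρ ∈ minimizers W κ',
      sInf (energySet W κ) - ε ≤ interactionE W ρ ∧
        interactionE W ρ ≤ sSup (energySet W κ) + ε := by
  by_contra! hcon
  have hcon' : ∀ n : ℕ, ∃ κ', |κ' - κ| < 1 / ((n:ℝ) + 1) ∧ ∃ ρ ∈ minimizers W κ',
      (sInf (energySet W κ) - ε ≤ interactionE W ρ →
        sSup (energySet W κ) + ε < interactionE W ρ) := fun n => by
    obtain ⟨κ', h1, ρ, h2, h3⟩ := hcon (1 / ((n:ℝ) + 1)) (by positivity)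
    exact ⟨κ', h1, ρ, h2, h3⟩
  choose k hk ρ hρ hbad using hcon'
  have hup : ∀ n, freeEnergy W (ρ n) κ ≤ minFreeEnergy W κ + C * (1 / ((n:ℝ) + 1)) := by
    intro n
    obtain ⟨r, hr⟩ := min_nonempty hWc hC0 hC κ
    have h1 := m_shift hWc hC hr (k n)
    rw [F_shift (ρ n) (k n) κ, (hρ n).2]
    have b1 := E_bound hWc hC hr.1
    have b2 := E_bound hWc hC (hρ n).1
    have h2 : |(k n - κ) * (interactionE W (ρ n) - interactionE W r)| ≤ 1 / ((n:ℝ) + 1) * (C + C) := by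
      rw [abs_mul]
      exact mul_le_mul (hk n).le ((abs_sub _ _).trans (add_le_add b2 b1)) (abs_nonneg _)
        (by positivity)
    have h3 := (abs_le.1 h2).2
    nlinarith
  obtain ⟨ns, hns, r, hr, hlim⟩ := compactness hWc hC0 hC (κ := κ) ρ (fun n => (hρ n).1) (by
    refine tendsto_of_tendsto_of_tendsto_of_le_of_le tendsto_const_nhds ?_
      (fun n => m_le hWc hC (hρ n).1 κ) hup
    simpa using (tendsto_const_nhds (x := minFreeEnergy W κ)).add
      ((tendsto_one_div_add_atTop_nhds_zero_nat (𝕜 := ℝ)).const_mul C))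
  have i1 : sInf (energySet W κ) ≤ interactionE W r := csInf_le (es_bound hWc hC κ).2 ⟨r, hr, rfl⟩
  have i2 : interactionE W r ≤ sSup (energySet W κ) := le_csSup (es_bound hWc hC κ).1 ⟨r, hr, rfl⟩
  obtain ⟨N, hN⟩ := Metric.tendsto_atTop.1 hlim ε hε
  have := abs_lt.1 (hN N le_rfl)
  have := hbad (ns N) (by linarith)
  linarith

lemma mono_E (hWc : Continuous W) (hC : ∀ x, |W x| ≤ C) {k1 k2 : ℝ} (h : k1 < k2) {a b : ℝ → ℝ}
    (ha : a ∈ minimizers W k1) (hb : b ∈ minimizers W k2) :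
    interactionE W a ≤ interactionE W b := by
  have h1 := m_shift hWc hC ha k2
  have h2 := m_shift hWc hC hb k1
  by_contra! hc
  nlinarith [mul_pos (sub_pos.2 h) (sub_pos.2 hc)]
end

/-- the one-sided derivatives of `m` exist, satisfy the envelope identities
`m′₋(κ) = −(1/2) inf_{ρ∈M(κ)} 𝓔(ρ,ρ)`, `m′₊(κ) = −(1/2) sup_{ρ∈M(κ)} 𝓔(ρ,ρ)`, and
`κ ↦ inf 𝓔`, `κ ↦ sup 𝓔` over `M(κ)` are non-decreasing. -/
theorem envelope_identities
    (W : ℝ → ℝ) (hWc : Continuous W) (hWe : ∀ θ, W (-θ) = W θ)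
    (hWper : Function.Periodic W (2 * π)) :
    (∀ κ : ℝ, 0 < κ →
      Filter.Tendsto
        (fun h : ℝ => (minFreeEnergy W κ - minFreeEnergy W (κ - h)) / h)
        (𝓝[>] (0:ℝ)) (𝓝 (-(1 / 2) * sInf (energySet W κ))) ∧
      Filter.Tendsto
        (fun h : ℝ => (minFreeEnergy W (κ + h) - minFreeEnergy W κ) / h)
        (𝓝[>] (0:ℝ)) (𝓝 (-(1 / 2) * sSup (energySet W κ)))) ∧
    (∀ κ₁ κ₂ : ℝ, 0 < κ₁ → κ₁ ≤ κ₂ →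
      sInf (energySet W κ₁) ≤ sInf (energySet W κ₂) ∧
      sSup (energySet W κ₁) ≤ sSup (energySet W κ₂)) := by

  obtain ⟨C, hC0, hC⟩ := exists_bound W hWc hWper
  refine ⟨fun κ hκ => ⟨?_, ?_⟩, ?_⟩
  · rw [Metric.tendsto_nhdsWithin_nhds]
    intro ε hε
    obtain ⟨δ, hδ, H⟩ := usc hWc hC0 hC κ hε
    refine ⟨δ, hδ, fun h hh hd => ?_⟩
    have hh' : 0 < h := hh
    rw [Real.dist_eq, sub_zero, abs_of_pos hh'] at hd
    obtain ⟨r, hr⟩ := min_nonempty hWc hC0 hC (κ - h)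
    have h1 := (H (κ - h) (by simpa [abs_of_pos hh'] using hd) r hr).1
    have h2 := m_shift hWc hC hr κ
    have up : (minFreeEnergy W κ - minFreeEnergy W (κ - h)) / h ≤
        -(1 / 2) * sInf (energySet W κ) + ε / 2 := by
      rw [div_le_iff₀ hh']
      nlinarith
    have lo : -(1 / 2) * sInf (energySet W κ) ≤
        (minFreeEnergy W κ - minFreeEnergy W (κ - h)) / h := by
      have : -2 * ((minFreeEnergy W κ - minFreeEnergy W (κ - h)) / h) ≤ sInf (energySet W κ) := by
        refine le_csInf (es_nonempty hWc hC0 hC κ) ?_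
        rintro v ⟨ρ, hρ, rfl⟩
        have h3 := m_shift hWc hC hρ (κ - h)
        rw [← mul_div_assoc, div_le_iff₀ hh']
        nlinarith
      linarith
    rw [Real.dist_eq, abs_lt]
    constructor <;> linarith
  · rw [Metric.tendsto_nhdsWithin_nhds]
    intro ε hε
    obtain ⟨δ, hδ, H⟩ := usc hWc hC0 hC κ hε
    refine ⟨δ, hδ, fun h hh hd => ?_⟩
    have hh' : 0 < h := hh
    rw [Real.dist_eq, sub_zero, abs_of_pos hh'] at hd
    obtain ⟨r, hr⟩ := min_nonempty hWc hC0 hC (κ + h)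
    have h1 := (H (κ + h) (by simpa [abs_of_pos hh'] using hd) r hr).2
    have h2 := m_shift hWc hC hr κ
    have lo : -(1 / 2) * sSup (energySet W κ) - ε / 2 ≤
        (minFreeEnergy W (κ + h) - minFreeEnergy W κ) / h := by
      rw [le_div_iff₀ hh']
      nlinarith
    have up : (minFreeEnergy W (κ + h) - minFreeEnergy W κ) / h ≤
        -(1 / 2) * sSup (energySet W κ) := by
      have : sSup (energySet W κ) ≤ -2 * ((minFreeEnergy W (κ + h) - minFreeEnergy W κ) / h) := by
        refine csSup_le (es_nonempty hWc hC0 hC κ) ?_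
        rintro v ⟨ρ, hρ, rfl⟩
        have h3 := m_shift hWc hC hρ (κ + h)
        rw [← mul_div_assoc, le_div_iff₀ hh']
        nlinarith
      linarith
    rw [Real.dist_eq, abs_lt]
    constructor <;> linarith
  · intro k1 k2 _ h12
    rcases h12.eq_or_lt with rfl | hlt
    · exact ⟨le_rfl, le_rfl⟩
    obtain ⟨a, ha⟩ := min_nonempty hWc hC0 hC k1
    obtain ⟨b, hb⟩ := min_nonempty hWc hC0 hC k2
    constructor
    · refine le_csInf ⟨_, b, hb, rfl⟩ ?_
      rintro v ⟨ρ, hρ, rfl⟩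
      exact (csInf_le (es_bound hWc hC k1).2 ⟨a, ha, rfl⟩).trans (mono_E hWc hC hlt ha hρ)
    · refine csSup_le ⟨_, a, ha, rfl⟩ ?_
      rintro v ⟨ρ, hρ, rfl⟩
      exact (mono_E hWc hC hlt hρ hb).trans (le_csSup (es_bound hWc hC k2).1 ⟨b, hb, rfl⟩)
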